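/- Let u : ℝ × ℝ → ℝ be a C² solution of the Born–Infeld equation satisfying the regularity/decay and smallness hypotheses. Then for every c₀ > 0 there is a constant K(c₀) > 0 such that ∫_2^∞ ∫_ℝ e^{-c₀|x|} ( (∂ₓu)² + (∂ₜu)² )(t,x) dx dt ≤ K(c₀) ε². -/

import Mathlib

open MeasureTheory Real Filter

/-- Time derivative `∂ₜ u` of a scalar field `u : ℝ × ℝ → ℝ` (first variable is time). -/
noncomputable def ut (u : ℝ × ℝ → ℝ) (t x : ℝ) : ℝ := deriv (fun s => u (s, x)) t

/-- Space derivative `∂ₓ u`. -/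
noncomputable def ux (u : ℝ × ℝ → ℝ) (t x : ℝ) : ℝ := deriv (fun y => u (t, y)) x

/-- `∂ₜ² u`. -/
noncomputable def utt (u : ℝ × ℝ → ℝ) (t x : ℝ) : ℝ := deriv (fun s => ut u s x) t

/-- `∂ₓ² u`. -/
noncomputable def uxx (u : ℝ × ℝ → ℝ) (t x : ℝ) : ℝ := deriv (fun y => ux u t y) x

/-- Mixed derivative `∂²ₜₓ u`. -/
noncomputable def utx (u : ℝ × ℝ → ℝ) (t x : ℝ) : ℝ := deriv (fun s => ux u s x) t

/-- The Born–Infeld equation in 1+1 dimensions: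
`(1 - (∂ₜu)²) ∂ₓ²u + 2 ∂ₓu ∂ₜu ∂²ₜₓu - (1 + (∂ₓu)²) ∂ₜ²u = 0`. -/
def IsBISol (u : ℝ × ℝ → ℝ) : Prop :=
  ∀ t x : ℝ,
    (1 - (ut u t x) ^ 2) * uxx u t x
      + 2 * ux u t x * ut u t x * utx u t x
      - (1 + (ux u t x) ^ 2) * utt u t x = 0

/-- The scaling function `λ(t) = C t / (log t)²`. -/
noncomputable def lam (C t : ℝ) : ℝ := C * t / (Real.log t) ^ 2

/-- Hyperbolic secant. -/
noncomputable def sech (x : ℝ) : ℝ := 1 / Real.cosh x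

section Virial

open Set

/-- The area density `√(1 + (∂ₓu)² - (∂ₜu)²)` of the Born–Infeld Lagrangian. -/
noncomputable def biDensity (p q : ℝ) : ℝ := √(1 + p ^ 2 - q ^ 2)

/-- The momentum density of the Born–Infeld equation, with `p = ∂ₓu` and `q = ∂ₜu`. -/
noncomputable def biMomentum (p q : ℝ) : ℝ := p * q / biDensity p q

/-- The momentum flux of the Born–Infeld equation, with `p = ∂ₓu` and `q = ∂ₜu`. -/
noncomputable def biStress (p q : ℝ) : ℝ := 1 - (1 - q ^ 2) / biDensity p q

section Pointwise

variable {p q : ℝ}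

lemma one_add_sq_sub_sq_pos (h : |p| + |q| ≤ 1 / 2) : 0 < 1 + p ^ 2 - q ^ 2 := by
  have hq : |q| ≤ 1 / 2 := by linarith [abs_nonneg p]
  nlinarith [sq_abs q, abs_nonneg q, sq_nonneg p]

lemma biDensity_pos (h : |p| + |q| ≤ 1 / 2) : 0 < biDensity p q :=
  sqrt_pos.2 (one_add_sq_sub_sq_pos h)

lemma biDensity_sq (h : |p| + |q| ≤ 1 / 2) : biDensity p q ^ 2 = 1 + p ^ 2 - q ^ 2 :=
  sq_sqrt (one_add_sq_sub_sq_pos h).le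

lemma biDensity_mem_Icc (h : |p| + |q| ≤ 1 / 2) : biDensity p q ∈ Icc (1 / 2) (3 / 2) := by
  have hp : |p| ≤ 1 / 2 := by linarith [abs_nonneg q]
  have hq : |q| ≤ 1 / 2 := by linarith [abs_nonneg p]
  have hp2 : p ^ 2 ≤ 1 / 4 := by nlinarith [sq_abs p, abs_nonneg p]
  have hq2 : q ^ 2 ≤ 1 / 4 := by nlinarith [sq_abs q, abs_nonneg q]
  have hD := biDensity_pos h
  have hD2 := biDensity_sq h
  constructor <;> nlinarith [sq_nonneg p, sq_nonneg q]

lemma abs_biMomentum_le (h : |p| + |q| ≤ 1 / 2) : |biMomentum p q| ≤ p ^ 2 + q ^ 2 := by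
  have hD := biDensity_mem_Icc h
  have hD0 := biDensity_pos h
  rw [biMomentum, abs_div, abs_of_pos hD0, div_le_iff₀ hD0, abs_mul]
  nlinarith [sq_nonneg (|p| - |q|), sq_abs p, sq_abs q, hD.1, sq_nonneg p, sq_nonneg q]

lemma le_biStress (h : |p| + |q| ≤ 1 / 2) : p ^ 2 + q ^ 2 ≤ 8 * biStress p q := by
  obtain ⟨h1, h2⟩ := biDensity_mem_Icc h
  have hD0 := biDensity_pos h
  have hD2 := biDensity_sq h
  set D := biDensity p q
  have key : biStress p q = (p ^ 2 + D * q ^ 2) / (D * (1 + D)) := by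
    change 1 - (1 - q ^ 2) / D = _
    field_simp
    linear_combination hD2
  rw [key, ← mul_div_assoc, le_div_iff₀ (by positivity)]
  have h3 : D * (1 + D) ≤ 4 := by nlinarith
  nlinarith [mul_le_mul_of_nonneg_left h3 (add_nonneg (sq_nonneg p) (sq_nonneg q)),
    mul_le_mul_of_nonneg_right h1 (sq_nonneg q), sq_nonneg p]

lemma biStress_zero : biStress 0 0 = 0 := by simp [biStress, biDensity]

end Pointwise

section Derivatives

variable {p q : ℝ → ℝ} {p' q' s : ℝ}

lemma HasDerivAt.biDensity (hp : HasDerivAt p p' s) (hq : HasDerivAt q q' s)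
    (h : |p s| + |q s| ≤ 1 / 2) :
    HasDerivAt (fun s => _root_.biDensity (p s) (q s))
      ((p s * p' - q s * q') / _root_.biDensity (p s) (q s)) s := by
  have hD := biDensity_pos h
  have := (((hp.pow 2).const_add 1).sub (hq.pow 2)).sqrt (one_add_sq_sub_sq_pos h).ne'
  refine this.congr_deriv ?_
  simp only [_root_.biDensity, Pi.sub_apply, Pi.pow_apply] at hD ⊢
  field_simp
  ring

lemma HasDerivAt.biMomentum (hp : HasDerivAt p p' s) (hq : HasDerivAt q q' s)
    (h : |p s| + |q s| ≤ 1 / 2) :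
    HasDerivAt (fun s => _root_.biMomentum (p s) (q s))
      ((p' * q s * (1 - q s ^ 2) + p s * q' * (1 + p s ^ 2)) /
        _root_.biDensity (p s) (q s) ^ 3) s := by
  have hD := biDensity_pos h
  have hD2 := biDensity_sq h
  refine ((hp.mul hq).div (hp.biDensity hq h) hD.ne').congr_deriv ?_
  simp only [Pi.mul_apply]
  field_simp
  rw [hD2]
  ring

lemma HasDerivAt.biStress (hp : HasDerivAt p p' s) (hq : HasDerivAt q q' s)
    (h : |p s| + |q s| ≤ 1 / 2) :
    HasDerivAt (fun s => _root_.biStress (p s) (q s))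
      ((p s * (1 - q s ^ 2) * p' + q s * (1 + 2 * p s ^ 2 - q s ^ 2) * q') /
        _root_.biDensity (p s) (q s) ^ 3) s := by
  have hD := biDensity_pos h
  have hD2 := biDensity_sq h
  refine ((((hq.pow 2).const_sub 1).div (hp.biDensity hq h) hD.ne').const_sub 1).congr_deriv ?_
  simp only [Pi.pow_apply]
  field_simp
  rw [hD2]
  ring

end Derivatives

section Smoothness

variable {E : Type*} [NormedAddCommGroup E] [NormedSpace ℝ E] {p q : E → ℝ} {n : WithTop ℕ∞}

lemma ContDiff.biDensity (hp : ContDiff ℝ n p) (hq : ContDiff ℝ n q)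
    (h : ∀ z, |p z| + |q z| ≤ 1 / 2) :
    ContDiff ℝ n (fun z => _root_.biDensity (p z) (q z)) :=
  ((contDiff_const.add (hp.pow 2)).sub (hq.pow 2)).sqrt fun z => (one_add_sq_sub_sq_pos (h z)).ne'

lemma ContDiff.biMomentum (hp : ContDiff ℝ n p) (hq : ContDiff ℝ n q)
    (h : ∀ z, |p z| + |q z| ≤ 1 / 2) :
    ContDiff ℝ n (fun z => _root_.biMomentum (p z) (q z)) :=
  (hp.mul hq).div (hp.biDensity hq h) fun z => (biDensity_pos (h z)).ne'

lemma ContDiff.biStress (hp : ContDiff ℝ n p) (hq : ContDiff ℝ n q)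
    (h : ∀ z, |p z| + |q z| ≤ 1 / 2) :
    ContDiff ℝ n (fun z => _root_.biStress (p z) (q z)) :=
  contDiff_const.sub ((contDiff_const.sub (hq.pow 2)).div (hp.biDensity hq h)
    fun z => (biDensity_pos (h z)).ne')

end Smoothness

section Slices

variable {f : ℝ × ℝ → ℝ}

lemma HasFDerivAt.hasDerivAt_fst {f' : ℝ × ℝ →L[ℝ] ℝ} {t x : ℝ} (h : HasFDerivAt f f' (t, x)) :
    HasDerivAt (fun s => f (s, x)) (f' (1, 0)) t :=
  h.comp_hasDerivAt t ((hasDerivAt_id t).prodMk (hasDerivAt_const t x))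

lemma HasFDerivAt.hasDerivAt_snd {f' : ℝ × ℝ →L[ℝ] ℝ} {t x : ℝ} (h : HasFDerivAt f f' (t, x)) :
    HasDerivAt (fun y => f (t, y)) (f' (0, 1)) x :=
  h.comp_hasDerivAt x ((hasDerivAt_const x t).prodMk (hasDerivAt_id x))

lemma ut_eq_fderiv (hf : Differentiable ℝ f) (t x : ℝ) : ut f t x = fderiv ℝ f (t, x) (1, 0) :=
  (hf (t, x)).hasFDerivAt.hasDerivAt_fst.deriv

lemma ux_eq_fderiv (hf : Differentiable ℝ f) (t x : ℝ) : ux f t x = fderiv ℝ f (t, x) (0, 1) :=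
  (hf (t, x)).hasFDerivAt.hasDerivAt_snd.deriv

end Slices

section Solutions

variable {u : ℝ × ℝ → ℝ}

lemma contDiff_ut (hu : ContDiff ℝ 2 u) : ContDiff ℝ 1 (fun z : ℝ × ℝ => ut u z.1 z.2) := by
  simp only [ut_eq_fderiv (hu.differentiable (by norm_num))]
  exact (hu.fderiv_right (by norm_num)).clm_apply contDiff_const

lemma contDiff_ux (hu : ContDiff ℝ 2 u) : ContDiff ℝ 1 (fun z : ℝ × ℝ => ux u z.1 z.2) := by
  simp only [ux_eq_fderiv (hu.differentiable (by norm_num))]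
  exact (hu.fderiv_right (by norm_num)).clm_apply contDiff_const

lemma hasDerivAt_ut_fst (hu : ContDiff ℝ 2 u) (t x : ℝ) :
    HasDerivAt (fun s => ut u s x) (utt u t x) t :=
  ((contDiff_ut hu).differentiable one_ne_zero (t, x)).hasFDerivAt.hasDerivAt_fst
    |>.differentiableAt.hasDerivAt

lemma hasDerivAt_ux_fst (hu : ContDiff ℝ 2 u) (t x : ℝ) :
    HasDerivAt (fun s => ux u s x) (utx u t x) t :=
  ((contDiff_ux hu).differentiable one_ne_zero (t, x)).hasFDerivAt.hasDerivAt_fst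
    |>.differentiableAt.hasDerivAt

lemma hasDerivAt_ux_snd (hu : ContDiff ℝ 2 u) (t x : ℝ) :
    HasDerivAt (fun y => ux u t y) (uxx u t x) x :=
  ((contDiff_ux hu).differentiable one_ne_zero (t, x)).hasFDerivAt.hasDerivAt_snd
    |>.differentiableAt.hasDerivAt

/-- Symmetry of the second derivative: `∂ₓ∂ₜu = ∂ₜ∂ₓu`. -/
lemma hasDerivAt_ut_snd (hu : ContDiff ℝ 2 u) (t x : ℝ) :
    HasDerivAt (fun y => ut u t y) (utx u t x) x := by
  have hd : Differentiable ℝ u := hu.differentiable (by norm_num)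
  have h2 : HasFDerivAt (fderiv ℝ u) (fderiv ℝ (fderiv ℝ u) (t, x)) (t, x) :=
    ((hu.fderiv_right (m := 1) (by norm_num)).differentiable one_ne_zero (t, x)).hasFDerivAt
  have happ (v : ℝ × ℝ) := h2.clm_apply (hasFDerivAt_const v (t, x))
  have hsymm : IsSymmSndFDerivAt ℝ u (t, x) :=
    hu.contDiffAt.isSymmSndFDerivAt (by simp)
  have hx := (happ (1, 0)).hasDerivAt_snd
  have ht := (happ (0, 1)).hasDerivAt_fst
  have hutx := hasDerivAt_ux_fst hu t x
  simp only [ux_eq_fderiv hd] at hutx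
  simp only [ut_eq_fderiv hd]
  refine hx.congr_deriv ?_
  rw [hutx.unique ht]
  simpa using hsymm.eq (0, 1) (1, 0)

/-- Local conservation of momentum, `∂ₜ(momentum) = ∂ₓ(flux)`. -/
lemma fderiv_biMomentum_eq (hu : ContDiff ℝ 2 u) (hBI : IsBISol u)
    (h : ∀ t x : ℝ, |ux u t x| + |ut u t x| ≤ 1 / 2) (z : ℝ × ℝ) :
    fderiv ℝ (fun z : ℝ × ℝ => biMomentum (ux u z.1 z.2) (ut u z.1 z.2)) z (1, 0) =
      fderiv ℝ (fun z : ℝ × ℝ => biStress (ux u z.1 z.2) (ut u z.1 z.2)) z (0, 1) := by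
  obtain ⟨t, x⟩ := z
  have hF := ((contDiff_ux hu).biMomentum (contDiff_ut hu) fun z => h z.1 z.2).differentiable
    one_ne_zero (t, x)
  have hS := ((contDiff_ux hu).biStress (contDiff_ut hu) fun z => h z.1 z.2).differentiable
    one_ne_zero (t, x)
  rw [hF.hasFDerivAt.hasDerivAt_fst.unique
      ((hasDerivAt_ux_fst hu t x).biMomentum (hasDerivAt_ut_fst hu t x) (h t x)),
    hS.hasFDerivAt.hasDerivAt_snd.unique
      ((hasDerivAt_ux_snd hu t x).biStress (hasDerivAt_ut_snd hu t x) (h t x))]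
  congr 1
  linear_combination -ux u t x * hBI t x

/-- The virial identity with multiplier `arctan`, on a rectangle outside of whose spatial extent the
solution vanishes. -/
lemma integral_weighted_biStress (hu : ContDiff ℝ 2 u) (hBI : IsBISol u)
    (h : ∀ t x : ℝ, |ux u t x| + |ut u t x| ≤ 1 / 2) {a b R : ℝ} (hab : a ≤ b)
    (hR : ∀ t ∈ Icc a b, ∀ x : ℝ, R ≤ |x| → ux u t x = 0 ∧ ut u t x = 0) :
    ∫ t in a..b, ∫ x in -R..R, 1 / (1 + x ^ 2) * biStress (ux u t x) (ut u t x) =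
      (∫ x in -R..R, arctan x * biMomentum (ux u a x) (ut u a x)) -
        ∫ x in -R..R, arctan x * biMomentum (ux u b x) (ut u b x) := by
  set F : ℝ × ℝ → ℝ := fun z => biMomentum (ux u z.1 z.2) (ut u z.1 z.2) with hFdef
  set S : ℝ × ℝ → ℝ := fun z => biStress (ux u z.1 z.2) (ut u z.1 z.2) with hSdef
  have hF : ContDiff ℝ 1 F := (contDiff_ux hu).biMomentum (contDiff_ut hu) fun z => h z.1 z.2
  have hS : ContDiff ℝ 1 S := (contDiff_ux hu).biStress (contDiff_ut hu) fun z => h z.1 z.2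
  have hφ : ContDiff ℝ 1 (fun z : ℝ × ℝ => arctan z.2) := contDiff_arctan.comp contDiff_snd
  have hf : ContDiff ℝ 1 (fun z : ℝ × ℝ => -(arctan z.2 * F z)) := (hφ.mul hF).neg
  have hg : ContDiff ℝ 1 (fun z : ℝ × ℝ => arctan z.2 * S z) := hφ.mul hS
  have hdiv (z : ℝ × ℝ) : fderiv ℝ (fun z : ℝ × ℝ => -(arctan z.2 * F z)) z (1, 0) +
      fderiv ℝ (fun z : ℝ × ℝ => arctan z.2 * S z) z (0, 1) = 1 / (1 + z.2 ^ 2) * S z := by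
    obtain ⟨t, x⟩ := z
    have hF1 := (hF.differentiable one_ne_zero (t, x)).hasFDerivAt.hasDerivAt_fst
    have hS1 := (hS.differentiable one_ne_zero (t, x)).hasFDerivAt.hasDerivAt_snd
    rw [(hf.differentiable one_ne_zero (t, x)).hasFDerivAt.hasDerivAt_fst.unique
        (hF1.const_mul (arctan x)).neg,
      (hg.differentiable one_ne_zero (t, x)).hasFDerivAt.hasDerivAt_snd.unique
        ((hasDerivAt_arctan x).mul hS1), fderiv_biMomentum_eq hu hBI h]
    ring
  have hcont : Continuous fun z : ℝ × ℝ => 1 / (1 + z.2 ^ 2) * S z :=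
    (continuous_const.div (by fun_prop) fun z => by positivity).mul hS.continuous
  have key := integral2_divergence_prod_of_hasFDerivAt_off_countable
    (fun z : ℝ × ℝ => -(arctan z.2 * F z)) (fun z : ℝ × ℝ => arctan z.2 * S z) _ _ a (-R) b R ∅
    countable_empty hf.continuous.continuousOn hg.continuous.continuousOn
    (fun z _ => (hf.differentiable one_ne_zero z).hasFDerivAt)
    (fun z _ => (hg.differentiable one_ne_zero z).hasFDerivAt)
    (by
      simp only [hdiv]
      exact hcont.continuousOn.integrableOn_compact (isCompact_uIcc.prod isCompact_uIcc))
  simp only [hdiv] at key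
  have hedge (y : ℝ) (hy : R ≤ |y|) : ∫ t in a..b, arctan y * S (t, y) = 0 := by
    rw [intervalIntegral.integral_congr (g := fun _ => (0 : ℝ)), intervalIntegral.integral_zero]
    intro t ht
    rw [uIcc_of_le hab] at ht
    simp [hSdef, (hR t ht y hy).1, (hR t ht y hy).2, biStress_zero]
  rw [hedge R (le_abs_self R), hedge (-R) (by rw [abs_neg]; exact le_abs_self R)] at key
  simp only [intervalIntegral.integral_neg] at key
  rw [key]
  ring

lemma abs_integral_arctan_mul_biMomentum_le (hu : ContDiff ℝ 2 u)
    (h : ∀ t x : ℝ, |ux u t x| + |ut u t x| ≤ 1 / 2) {t R : ℝ} (hR0 : 0 ≤ R)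
    (hR : ∀ x : ℝ, R ≤ |x| → ux u t x = 0 ∧ ut u t x = 0) :
    |∫ x in -R..R, arctan x * biMomentum (ux u t x) (ut u t x)| ≤
      2 * ∫ x : ℝ, (ux u t x ^ 2 + ut u t x ^ 2) := by
  have hc : Continuous fun x => ux u t x ^ 2 + ut u t x ^ 2 :=
    (((contDiff_ux hu).continuous.comp (by fun_prop : Continuous fun x : ℝ => (t, x))).pow 2).add
      (((contDiff_ut hu).continuous.comp (by fun_prop : Continuous fun x : ℝ => (t, x))).pow 2)
  rw [← intervalIntegral.integral_eq_integral_of_support_subset (a := -R) (b := R),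
    ← intervalIntegral.integral_const_mul]
  · rw [← norm_eq_abs]
    refine intervalIntegral.norm_integral_le_of_norm_le (by linarith)
      (ae_of_all _ fun x _ => ?_) (Continuous.intervalIntegrable (hc.const_mul 2) _ _)
    rw [norm_mul, norm_eq_abs, norm_eq_abs]
    have hx : |arctan x| ≤ 2 := by
      rw [abs_le]
      constructor <;> linarith [neg_pi_div_two_lt_arctan x, arctan_lt_pi_div_two x, pi_lt_four]
    exact mul_le_mul hx (abs_biMomentum_le (h t x)) (abs_nonneg _) (by norm_num)
  · intro x hx
    by_contra hmem
    have hx' : R ≤ |x| := by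
      by_contra! hlt
      exact hmem ⟨(abs_lt.1 hlt).1, (abs_lt.1 hlt).2.le⟩
    exact hx (by simp [(hR x hx').1, (hR x hx').2])

end Solutions

lemma exp_neg_mul_abs_le {c : ℝ} (hc : 0 < c) (x : ℝ) :
    exp (-c * |x|) ≤ (1 + 2 / c ^ 2) * (1 / (1 + x ^ 2)) := by
  have h1 : 1 + c * |x| + (c * |x|) ^ 2 / 2 ≤ exp (c * |x|) :=
    quadratic_le_exp_of_nonneg (by positivity)
  have h2 : 1 + x ^ 2 ≤ (1 + 2 / c ^ 2) * exp (c * |x|) := by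
    calc 1 + x ^ 2 ≤ (1 + 2 / c ^ 2) * (1 + (c * |x|) ^ 2 / 2) := by
          rw [mul_pow, sq_abs]
          have : (1 + 2 / c ^ 2) * (1 + c ^ 2 * x ^ 2 / 2) =
              1 + x ^ 2 + (2 / c ^ 2 + c ^ 2 * x ^ 2 / 2) := by
            field_simp
            ring
          rw [this]
          have : 0 ≤ 2 / c ^ 2 + c ^ 2 * x ^ 2 / 2 := by positivity
          linarith
      _ ≤ _ := by
          gcongr
          have : 0 ≤ c * |x| := by positivity
          linarith
  rw [neg_mul, exp_neg, mul_one_div, inv_eq_one_div, div_le_div_iff₀ (exp_pos _) (by positivity)]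
  linarith

/-- The weighted energy on a finite time interval is controlled by the energies at its ends. -/
lemma integral_weighted_energy_le {u : ℝ × ℝ → ℝ} (hu : ContDiff ℝ 2 u) (hBI : IsBISol u)
    (h : ∀ t x : ℝ, |ux u t x| + |ut u t x| ≤ 1 / 2) {a b R c E : ℝ} (hab : a ≤ b) (hc : 0 < c)
    (hE : ∀ t : ℝ, ∫ x : ℝ, (ux u t x ^ 2 + ut u t x ^ 2) ≤ E)
    (hR : ∀ t ∈ Icc a b, ∀ x : ℝ, R ≤ |x| → ux u t x = 0 ∧ ut u t x = 0) (hR0 : 0 ≤ R) :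
    ∫ t in a..b, ∫ x in -R..R, exp (-c * |x|) * (ux u t x ^ 2 + ut u t x ^ 2) ≤
      32 * (1 + 2 / c ^ 2) * E := by
  have hp := (contDiff_ux hu).continuous
  have hq := (contDiff_ut hu).continuous
  have hS := ((contDiff_ux hu).biStress (contDiff_ut hu) fun z => h z.1 z.2).continuous
  have hS' : Continuous fun z : ℝ × ℝ =>
      1 / (1 + z.2 ^ 2) * biStress (ux u z.1 z.2) (ut u z.1 z.2) :=
    (continuous_const.div (by fun_prop) fun z => by positivity).mul hS
  have he : Continuous fun z : ℝ × ℝ =>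
      exp (-c * |z.2|) * (ux u z.1 z.2 ^ 2 + ut u z.1 z.2 ^ 2) := by fun_prop
  set M := 8 * (1 + 2 / c ^ 2) with hM
  have hM0 : 0 ≤ M := by positivity
  have hslice (t : ℝ) : Continuous fun x : ℝ => (t, x) := by fun_prop
  have hpt (t x : ℝ) : exp (-c * |x|) * (ux u t x ^ 2 + ut u t x ^ 2) ≤
      M * (1 / (1 + x ^ 2) * biStress (ux u t x) (ut u t x)) := by
    calc _ ≤ ((1 + 2 / c ^ 2) * (1 / (1 + x ^ 2))) * (8 * biStress (ux u t x) (ut u t x)) :=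
          mul_le_mul (exp_neg_mul_abs_le hc x) (le_biStress (h t x)) (by positivity)
            (by positivity)
      _ = _ := by rw [hM]; ring
  calc _ ≤ ∫ t in a..b, M * ∫ x in -R..R, 1 / (1 + x ^ 2) * biStress (ux u t x) (ut u t x) := by
        refine intervalIntegral.integral_mono_on hab ?_ ?_ fun t _ => ?_
        · exact Continuous.intervalIntegrable
            (intervalIntegral.continuous_parametric_intervalIntegral_of_continuous'
              (f := fun t x => exp (-c * |x|) * (ux u t x ^ 2 + ut u t x ^ 2)) he _ _) _ _
        · exact Continuous.intervalIntegrable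
            ((intervalIntegral.continuous_parametric_intervalIntegral_of_continuous'
              (f := fun t x => 1 / (1 + x ^ 2) * biStress (ux u t x) (ut u t x)) hS' _ _).const_mul
              M) _ _
        · rw [← intervalIntegral.integral_const_mul]
          refine intervalIntegral.integral_mono_on (by linarith) ?_ ?_ fun x _ => hpt t x
          · exact (he.comp (hslice t)).intervalIntegrable _ _
          · exact ((hS'.comp (hslice t)).const_mul M).intervalIntegrable _ _
    _ = M * ((∫ x in -R..R, arctan x * biMomentum (ux u a x) (ut u a x)) -
          ∫ x in -R..R, arctan x * biMomentum (ux u b x) (ut u b x)) := by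
        rw [intervalIntegral.integral_const_mul,
          integral_weighted_biStress hu hBI h hab hR]
    _ ≤ M * (2 * E + 2 * E) := by
        have ha := abs_le.1 (abs_integral_arctan_mul_biMomentum_le hu h hR0
          (hR a (left_mem_Icc.2 hab)))
        have hb := abs_le.1 (abs_integral_arctan_mul_biMomentum_le hu h hR0
          (hR b (right_mem_Icc.2 hab)))
        gcongr
        linarith [ha.2, hb.1, hE a, hE b]
    _ = _ := by rw [hM]; ring

/-- A `lintegral` over a half-line of lintegrals of a nonnegative continuous function with compact
spatial support, locally uniformly in time, is bounded as soon as all the iterated interval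
integrals are. -/
lemma lintegral_Ioi_lintegral_le {f : ℝ → ℝ → ℝ} (hf : Continuous f.uncurry)
    (h0 : ∀ t x, 0 ≤ f t x) {a B : ℝ}
    (hB : ∀ b, a ≤ b → ∃ R, (∀ t ∈ Icc a b, ∀ x : ℝ, R ≤ |x| → f t x = 0) ∧ 0 ≤ R ∧
      ∫ t in a..b, ∫ x in -R..R, f t x ≤ B) :
    ∫⁻ t in Ioi a, ∫⁻ x : ℝ, ENNReal.ofReal (f t x) ≤ ENNReal.ofReal B := by
  have hmeas : Measurable fun t => ∫⁻ x : ℝ, ENNReal.ofReal (f t x) :=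
    Measurable.lintegral_prod_right (f := fun t x => ENNReal.ofReal (f t x))
      (ENNReal.measurable_ofReal.comp hf.measurable)
  refine le_of_tendsto (((aecover_Iic (μ := volume) tendsto_id).restrict
    (s := Ioi a)).lintegral_tendsto_of_countably_generated hmeas.aemeasurable)
    ((eventually_ge_atTop a).mono fun b hb => ?_)
  obtain ⟨R, hR, hR0, hle⟩ := hB b hb
  rw [Measure.restrict_restrict measurableSet_Iic, inter_comm, id, Ioi_inter_Iic]
  have hinner : ∀ t ∈ Ioc a b, ∫⁻ x : ℝ, ENNReal.ofReal (f t x) =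
      ENNReal.ofReal (∫ x in -R..R, f t x) := by
    intro t ht
    have hsupp : Function.support (f t) ⊆ Ioc (-R) R := by
      intro x hx
      by_contra hmem
      refine hx (hR t (Ioc_subset_Icc_self ht) x ?_)
      by_contra! hlt
      exact hmem ⟨(abs_lt.1 hlt).1, (abs_lt.1 hlt).2.le⟩
    have hcont : Continuous (f t) := hf.comp (by fun_prop : Continuous fun x : ℝ => (t, x))
    rw [intervalIntegral.integral_eq_integral_of_support_subset hsupp,
      ofReal_integral_eq_lintegral_ofReal _ (ae_of_all _ (h0 t))]
    rw [← integrableOn_iff_integrable_of_support_subset hsupp]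
    exact (hcont.integrableOn_Icc (a := -R) (b := R)).mono_set Ioc_subset_Icc_self
  rw [setLIntegral_congr_fun measurableSet_Ioc hinner,
    ← ofReal_integral_eq_lintegral_ofReal, ← intervalIntegral.integral_of_le hb]
  · exact ENNReal.ofReal_le_ofReal hle
  · exact ((intervalIntegral.continuous_parametric_intervalIntegral_of_continuous' (μ := volume) hf _ _
      ).integrableOn_Icc (a := a) (b := b)).mono_set Ioc_subset_Icc_self
  · exact ae_of_all _ fun t =>
      intervalIntegral.integral_nonneg (by linarith) fun x _ => h0 t x

end Virial

/-- Averaged local decay with exponential weight: for every `c₀ > 0` there is `K(c₀) > 0` with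
`∫_2^∞ ∫ e^{-c₀|x|} ((∂ₓu)² + (∂ₜu)²) dx dt ≤ K(c₀) ε²`. -/
theorem exponential_weight_decay :
    ∃ ε₀ : ℝ, 0 < ε₀ ∧ ∀ c₀ : ℝ, 0 < c₀ → ∃ K : ℝ, 0 < K ∧ ∀ ε : ℝ, 0 < ε → ε ≤ ε₀ →
    ∀ u : ℝ × ℝ → ℝ, ContDiff ℝ 2 u → IsBISol u →
    (∀ t x : ℝ, |ux u t x| + |ut u t x| ≤ ε) →
    (∀ t : ℝ, ∫ x : ℝ, ((ux u t x) ^ 2 + (ut u t x) ^ 2) ≤ ε ^ 2) →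
    (∀ T : ℝ, ∃ R : ℝ, ∀ t x : ℝ, |t| ≤ T → R ≤ |x| → ux u t x = 0 ∧ ut u t x = 0) →
      ∫⁻ t in Set.Ioi (2 : ℝ), ∫⁻ x : ℝ, ENNReal.ofReal
          (Real.exp (-c₀ * |x|) * ((ux u t x) ^ 2 + (ut u t x) ^ 2))
        ≤ ENNReal.ofReal (K * ε ^ 2) := by
  refine ⟨1 / 2, by norm_num, fun c hc => ⟨32 * (1 + 2 / c ^ 2), by positivity, ?_⟩⟩
  intro ε _ hε u hu hBI hsup hE hsupp
  have h (t x : ℝ) : |ux u t x| + |ut u t x| ≤ 1 / 2 := (hsup t x).trans hε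
  have hp := (contDiff_ux hu).continuous
  have hq := (contDiff_ut hu).continuous
  refine lintegral_Ioi_lintegral_le
    (f := fun t x => exp (-c * |x|) * (ux u t x ^ 2 + ut u t x ^ 2))
    (by unfold Function.uncurry; fun_prop) (fun t x => by positivity) fun b hb => ?_
  obtain ⟨R, hR⟩ := hsupp b
  have hR' : ∀ t ∈ Set.Icc 2 b, ∀ x : ℝ, |R| ≤ |x| → ux u t x = 0 ∧ ut u t x = 0 :=
    fun t ht x hx => hR t x (by rw [abs_of_nonneg (by linarith [ht.1])]; exact ht.2)
      ((le_abs_self R).trans hx)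
  refine ⟨|R|, fun t ht x hx => ?_, abs_nonneg R,
    integral_weighted_energy_le hu hBI h hb hc hE hR' (abs_nonneg R)⟩
  simp [(hR' t ht x hx).1, (hR' t ht x hx).2]
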